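/- arXiv:1712.09647 — 4 statements merged into one kernel-verified Lean document; each statement's English description precedes it below -/
import Mathlib

section
/- Let 𝓕 be a Kalton space on U with values in Σ and let s ∈ U. The following assertions are equivalent: (1) the restriction of the evaluation map δ_s to ker δ'_s is surjective onto X_s; (2) 𝓕 = ker δ_s + ker δ'_s; (3) there exists a constant M > 0 such that every f ∈ 𝓕 can be written as f = g + h with g ∈ ker δ_s, h ∈ ker δ'_s and max{‖g‖_𝓕, ‖h‖_𝓕} ≤ M‖f‖_𝓕; (4) f'(s) ∈ X_s for every f ∈ 𝓕; (5) δ'_s is a bounded operator from 𝓕 to X_s, i.e. there is a constant K with ‖f'(s)‖_s ≤ K‖f‖_𝓕 for all f ∈ 𝓕. -/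
open Complex Metric Set

noncomputable section

/-- A conformal equivalence (analytic bijection) of `U` onto `V`. -/
def ConformalEquivOn (φ : ℂ → ℂ) (U V : Set ℂ) : Prop :=
  DifferentiableOn ℂ φ U ∧ Set.BijOn φ U V

/-- A Kalton space of analytic functions on an open set `U ⊆ ℂ` conformally equivalent to the
open unit disc, with values in the complex Banach space `Sig`.  The Banach carrier is `F`, whose
elements are identified with analytic functions `ℂ → Sig` (only the restriction to `U` matters)
via the injective linear map `toFun`. -/
structure KaltonSpace (U : Set ℂ) (Sig : Type*) (F : Type*)
    [NormedAddCommGroup Sig] [NormedSpace ℂ Sig] [CompleteSpace Sig]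
    [NormedAddCommGroup F] [NormedSpace ℂ F] [CompleteSpace F] where
  isOpen : IsOpen U
  conformal_exists : ∃ φ : ℂ → ℂ, ConformalEquivOn φ U (Metric.ball (0 : ℂ) 1)
  toFun : F →ₗ[ℂ] (ℂ → Sig)
  inj : ∀ f g : F, Set.EqOn (toFun f) (toFun g) U → f = g
  analytic : ∀ f : F, DifferentiableOn ℂ (toFun f) U
  eval_bound : ∀ z ∈ U, ∃ C : ℝ, ∀ f : F, ‖toFun f z‖ ≤ C * ‖f‖
  conf_mul_mem : ∀ φ : ℂ → ℂ, ConformalEquivOn φ U (Metric.ball (0 : ℂ) 1) →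
    ∀ f : F, ∃ g : F, (∀ z ∈ U, toFun g z = φ z • toFun f z) ∧ ‖g‖ = ‖f‖
  conf_div_mem : ∀ φ : ℂ → ℂ, ConformalEquivOn φ U (Metric.ball (0 : ℂ) 1) →
    ∀ h : ℂ → Sig, DifferentiableOn ℂ h U →
    ∀ g : F, (∀ z ∈ U, toFun g z = φ z • h z) →
    ∃ f : F, (∀ z ∈ U, toFun f z = h z) ∧ ‖f‖ = ‖g‖

namespace KaltonSpace

variable {U : Set ℂ} {Sig F : Type*}
  [NormedAddCommGroup Sig] [NormedSpace ℂ Sig] [CompleteSpace Sig]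
  [NormedAddCommGroup F] [NormedSpace ℂ F] [CompleteSpace F]

/-- `x` belongs to the interpolation space `X_z = {f z : f ∈ 𝓕}`. -/
def MemX (K : KaltonSpace U Sig F) (z : ℂ) (x : Sig) : Prop :=
  ∃ f : F, K.toFun f z = x

/-- The quotient norm `‖x‖_z = inf {‖f‖ : f ∈ 𝓕, f z = x}` of `X_z`. -/
def normX (K : KaltonSpace U Sig F) (z : ℂ) (x : Sig) : ℝ :=
  sInf {r : ℝ | ∃ f : F, K.toFun f z = x ∧ r = ‖f‖}

/-- `B` is a homogeneous bounded selection for the evaluation `δ_z`, with constant `c`. -/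
def IsSelection (K : KaltonSpace U Sig F) (z : ℂ) (c : ℝ) (B : Sig → F) : Prop :=
  (∀ (l : ℂ) (x : Sig), K.MemX z x → B (l • x) = l • B x) ∧
  (∀ x : Sig, K.MemX z x → K.toFun (B x) z = x) ∧
  (∀ x : Sig, K.MemX z x → ‖B x‖ ≤ c * K.normX z x)

end KaltonSpace

open Filter Topology ComplexConjugate

/-- An injective holomorphic function on an open set has nonvanishing derivative. -/
theorem Set.InjOn.deriv_ne_zero_of_isOpen {f : ℂ → ℂ} {U : Set ℂ} {a : ℂ} (hinj : InjOn f U)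
    (hU : IsOpen U) (hf : DifferentiableOn ℂ f U) (ha : a ∈ U) : deriv f a ≠ 0 := by
  have hopen : ∀ z ∈ U, 𝓝 (f z) ≤ map f (𝓝 z) := by
    intro z hz
    refine (hf.analyticAt
      (hU.mem_nhds hz)).eventually_constant_or_nhds_le_map_nhds.resolve_left fun hc => ?_
    obtain ⟨w, ⟨hw, hwU⟩, hne⟩ := (((hc.and (hU.mem_nhds hz)).filter_mono
      nhdsWithin_le_nhds).and (self_mem_nhdsWithin (a := z) (s := {z}ᶜ))).exists
    exact hne (hinj hwU hz hw)
  have hderiv : ∀ᶠ z in 𝓝[≠] a, deriv f z ≠ 0 := by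
    refine ((hf.analyticAt
      (hU.mem_nhds ha)).deriv.eventually_eq_zero_or_eventually_ne_zero).resolve_left fun hz => ?_
    obtain ⟨r, hr, hball⟩ := Metric.eventually_nhds_iff_ball.1 (hz.and (hU.mem_nhds ha))
    have hhalf : a + (r / 2 : ℝ) ∈ ball a r := by
      simp [abs_of_pos hr, hr]
    have hconst : f (a + (r / 2 : ℝ)) = f a :=
      isOpen_ball.is_const_of_deriv_eq_zero (convex_ball a r).isPreconnected
        (fun z hz => (hf.differentiableAt (hU.mem_nhds (hball z hz).2)).differentiableWithinAt)
        (fun z hz => (hball z hz).1) hhalf (mem_ball_self hr)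
    have h := hinj (hball _ hhalf).2 ha hconst
    simp [hr.ne'] at h
  set g := Function.invFunOn f U
  have hgf : ∀ z ∈ U, g (f z) = z := fun z hz => hinj.leftInvOn_invFunOn hz
  have hfg : ∀ z ∈ U, ∀ᶠ y in 𝓝 (f z), f (g y) = y := fun z hz => by
    refine hopen z hz (mem_map.2 ?_)
    filter_upwards [hU.mem_nhds hz] with w hw
    simp [hgf w hw]
  have hgc : ∀ z ∈ U, ContinuousAt g (f z) := fun z hz => by
    rw [ContinuousAt, hgf z hz]
    refine (tendsto_map'_iff.2 ?_).mono_left (hopen z hz)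
    refine tendsto_id.congr' ?_
    filter_upwards [hU.mem_nhds hz] with w hw
    exact (hgf w hw).symm
  have hgd : ∀ᶠ y in 𝓝[≠] f a, DifferentiableAt ℂ g y := by
    rw [eventually_nhdsWithin_iff] at hderiv ⊢
    refine hopen a ha (mem_map.2 ?_)
    filter_upwards [hderiv, hU.mem_nhds ha] with z hz hzU hne
    have hza : z ≠ a := fun h => hne (by simp [h])
    refine (HasDerivAt.of_local_left_inverse (hgc z hzU) ?_ (hz hza)
      (hfg z hzU)).differentiableAt
    rw [hgf z hzU]
    exact (hf.differentiableAt (hU.mem_nhds hzU)).hasDerivAt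
  have hg := (Complex.analyticAt_of_differentiable_on_punctured_nhds_of_continuousAt hgd
    (hgc a ha)).differentiableAt
  intro h0
  refine not_differentiableAt_of_local_left_inverse_hasDerivAt_zero (f := f) (a := f a)
    ?_ (hfg a ha) hg
  rw [hgf a ha, ← h0]
  exact (hf.differentiableAt (hU.mem_nhds ha)).hasDerivAt

/-- The disc automorphism `z ↦ (z - a) / (1 - conj a * z)`, vanishing at `a`. -/
def discAut (a z : ℂ) : ℂ := (z - a) / (1 - conj a * z)

theorem one_sub_conj_mul_ne_zero {a z : ℂ} (ha : ‖a‖ < 1) (hz : ‖z‖ < 1) :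
    1 - conj a * z ≠ 0 := by
  intro h
  have h1 : ‖conj a * z‖ = 1 := by rw [← sub_eq_zero.1 h, norm_one]
  rw [norm_mul, RCLike.norm_conj] at h1
  nlinarith [norm_nonneg a, norm_nonneg z]

theorem norm_discAut_lt_one {a z : ℂ} (ha : ‖a‖ < 1) (hz : ‖z‖ < 1) : ‖discAut a z‖ < 1 := by
  have hne := one_sub_conj_mul_ne_zero ha hz
  rw [discAut, norm_div, div_lt_one (norm_pos_iff.2 hne)]
  refine lt_of_pow_lt_pow_left₀ 2 (norm_nonneg _) ?_
  have key : ‖1 - conj a * z‖ ^ 2 - ‖z - a‖ ^ 2 = (1 - ‖a‖ ^ 2) * (1 - ‖z‖ ^ 2) := by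
    simp only [← Complex.normSq_eq_norm_sq, Complex.normSq_apply, Complex.sub_re, Complex.sub_im,
      Complex.mul_re, Complex.mul_im, Complex.conj_re, Complex.conj_im, Complex.one_re,
      Complex.one_im]
    ring
  have h1 : 0 < 1 - ‖a‖ ^ 2 := by nlinarith [norm_nonneg a]
  have h2 : 0 < 1 - ‖z‖ ^ 2 := by nlinarith [norm_nonneg z]
  nlinarith [mul_pos h1 h2]

theorem discAut_neg_discAut {a z : ℂ} (ha : ‖a‖ < 1) (hz : ‖z‖ < 1) :
    discAut (-a) (discAut a z) = z := by
  have h1 := one_sub_conj_mul_ne_zero ha hz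
  have h2 := one_sub_conj_mul_ne_zero (a := -a) (by rwa [norm_neg]) (norm_discAut_lt_one ha hz)
  rw [discAut, div_eq_iff h2, discAut, map_neg]
  generalize conj a = c at h1 ⊢
  have h3 : 1 - z * c ≠ 0 := by rwa [mul_comm]
  field_simp
  ring

theorem conformalEquivOn_discAut {a : ℂ} (ha : ‖a‖ < 1) :
    ConformalEquivOn (discAut a) (ball 0 1) (ball 0 1) := by
  have hna : ‖-a‖ < 1 := by rwa [norm_neg]
  refine ⟨?_, InvOn.bijOn (f' := discAut (-a)) ⟨fun z hz => ?_, fun z hz => ?_⟩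
    (fun z hz => ?_) (fun z hz => ?_)⟩
  · refine DifferentiableOn.div (by fun_prop) (by fun_prop) fun z hz => ?_
    exact one_sub_conj_mul_ne_zero ha (mem_ball_zero_iff.1 hz)
  · exact discAut_neg_discAut ha (mem_ball_zero_iff.1 hz)
  · simpa using discAut_neg_discAut hna (mem_ball_zero_iff.1 hz)
  · exact mem_ball_zero_iff.2 (norm_discAut_lt_one ha (mem_ball_zero_iff.1 hz))
  · exact mem_ball_zero_iff.2 (norm_discAut_lt_one hna (mem_ball_zero_iff.1 hz))

namespace KaltonSpace

variable {U : Set ℂ} {Sig F : Type*}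
  [NormedAddCommGroup Sig] [NormedSpace ℂ Sig] [CompleteSpace Sig]
  [NormedAddCommGroup F] [NormedSpace ℂ F] [CompleteSpace F]

theorem exists_conformalEquivOn_eq_zero (K : KaltonSpace U Sig F) {s : ℂ} (hs : s ∈ U) :
    ∃ φ : ℂ → ℂ, ConformalEquivOn φ U (ball 0 1) ∧ φ s = 0 := by
  obtain ⟨φ, hφ, hbij⟩ := K.conformal_exists
  obtain ⟨hd, hb⟩ := conformalEquivOn_discAut (mem_ball_zero_iff.1 (hbij.mapsTo hs))
  exact ⟨discAut (φ s) ∘ φ, ⟨hd.comp hφ hbij.mapsTo, hb.comp hbij⟩, by simp [discAut]⟩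

theorem differentiableAt (K : KaltonSpace U Sig F) {s : ℂ} (hs : s ∈ U) (f : F) :
    DifferentiableAt ℂ (K.toFun f) s :=
  (K.analytic f).differentiableAt (K.isOpen.mem_nhds hs)

/-- The evaluation `δ_s` as a continuous linear map. -/
def evalCLM (K : KaltonSpace U Sig F) {s : ℂ} (hs : s ∈ U) : F →L[ℂ] Sig :=
  LinearMap.mkContinuousOfExistsBound (LinearMap.proj s ∘ₗ K.toFun) (K.eval_bound s hs)

@[simp]
theorem evalCLM_apply (K : KaltonSpace U Sig F) {s : ℂ} (hs : s ∈ U) (f : F) :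
    K.evalCLM hs f = K.toFun f s := rfl

theorem exists_derivCLM (K : KaltonSpace U Sig F) {s : ℂ} (hs : s ∈ U) :
    ∃ D : F →L[ℂ] Sig, ∀ f, D f = deriv (K.toFun f) s := by
  classical
  let q : ℂ → F →L[ℂ] Sig := fun t =>
    if h : s + t ∈ U then t⁻¹ • (K.evalCLM h - K.evalCLM hs) else 0
  have hU : ∀ᶠ t in 𝓝[≠] (0 : ℂ), s + t ∈ U := by
    refine Filter.Eventually.filter_mono nhdsWithin_le_nhds ?_
    have hc : ContinuousAt (fun t : ℂ => s + t) 0 := by fun_prop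
    exact hc (by simpa using K.isOpen.mem_nhds hs)
  have hlim : Tendsto (fun t f => q t f) (𝓝[≠] 0) (𝓝 fun f => deriv (K.toFun f) s) := by
    refine tendsto_pi_nhds.2 fun f => ?_
    refine (hasDerivAt_iff_tendsto_slope_zero.1 (K.differentiableAt hs f).hasDerivAt).congr' ?_
    filter_upwards [hU] with t ht
    simp [q, ht]
  exact ⟨continuousLinearMapOfTendsto q hlim, fun _ => rfl⟩

/-- Multiplying by a conformal map vanishing at `s` lands in the kernel of `δ_s`, where the
derivative at `s` is `φ' s` times the original value. -/
theorem deriv_smul_of_eq_zero (K : KaltonSpace U Sig F) {s : ℂ} (hs : s ∈ U) {φ : ℂ → ℂ}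
    (hφ : DifferentiableOn ℂ φ U) (h0 : φ s = 0) {f g : F}
    (hg : ∀ z ∈ U, K.toFun g z = φ z • K.toFun f z) :
    deriv (K.toFun g) s = deriv φ s • K.toFun f s := by
  have hU := K.isOpen.mem_nhds hs
  have h : K.toFun g =ᶠ[𝓝 s] fun z => φ z • K.toFun f z := by
    filter_upwards [hU] with z hz using hg z hz
  rw [h.deriv_eq, deriv_fun_smul (hφ.differentiableAt hU) (K.differentiableAt hs f), h0]
  simp

/-- Elements of `ker δ_s` are divisible, isometrically, by a conformal map vanishing at `s`. -/
theorem exists_eq_smul_of_eval_eq_zero (K : KaltonSpace U Sig F) {s : ℂ} (hs : s ∈ U) {φ : ℂ → ℂ}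
    (hφ : ConformalEquivOn φ U (ball 0 1)) (h0 : φ s = 0) {g : F} (hg : K.toFun g s = 0) :
    ∃ f : F, (∀ z ∈ U, K.toFun g z = φ z • K.toFun f z) ∧ ‖f‖ = ‖g‖ := by
  have hU := K.isOpen.mem_nhds hs
  have hne : ∀ z ∈ U, dslope φ s z ≠ 0 := by
    intro z hz
    rcases eq_or_ne z s with rfl | hzs
    · rw [dslope_same]
      exact hφ.2.injOn.deriv_ne_zero_of_isOpen K.isOpen hφ.1 hz
    · rw [dslope_of_ne _ hzs, slope_def_field, h0, sub_zero]
      exact div_ne_zero (fun h => hzs (hφ.2.injOn hz hs (h.trans h0.symm))) (sub_ne_zero.2 hzs)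
  have hmul : ∀ z ∈ U, K.toFun g z =
      φ z • ((dslope φ s z)⁻¹ • dslope (K.toFun g) s z) := by
    intro z hz
    have h1 := sub_smul_dslope φ s z
    have h2 := sub_smul_dslope (K.toFun g) s z
    rw [h0, sub_zero, smul_eq_mul] at h1
    rw [hg, sub_zero] at h2
    rw [smul_smul, ← h1, mul_assoc, mul_inv_cancel₀ (hne z hz), mul_one, h2]
  obtain ⟨f, hf, hn⟩ := K.conf_div_mem φ hφ _
    ((((Complex.differentiableOn_dslope hU).2 hφ.1).inv hne).smul
      ((Complex.differentiableOn_dslope hU).2 (K.analytic g))) g hmul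
  exact ⟨f, fun z hz => by rw [hf z hz]; exact hmul z hz, hn⟩

theorem normX_le (K : KaltonSpace U Sig F) {s : ℂ} {x : Sig} {f : F} (hf : K.toFun f s = x) :
    K.normX s x ≤ ‖f‖ :=
  csInf_le ⟨0, by rintro _ ⟨g, -, rfl⟩; exact norm_nonneg g⟩ ⟨f, hf, rfl⟩

/-- If `𝓕 = ker δ_s + ker δ'_s` then the decomposition can be chosen with norm control. -/
theorem exists_bounded_splitting (K : KaltonSpace U Sig F) {s : ℂ} (hs : s ∈ U)
    (h : ∀ f : F, ∃ g h : F, f = g + h ∧ K.toFun g s = 0 ∧ deriv (K.toFun h) s = 0) :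
    ∃ M : ℝ, 0 < M ∧ ∀ f : F, ∃ g h : F, f = g + h ∧ K.toFun g s = 0 ∧
      deriv (K.toFun h) s = 0 ∧ max ‖g‖ ‖h‖ ≤ M * ‖f‖ := by
  obtain ⟨D, hD⟩ := K.exists_derivCLM hs
  let E := K.evalCLM hs
  have : CompleteSpace E.ker := E.isClosed_ker.completeSpace_coe
  have : CompleteSpace D.ker := D.isClosed_ker.completeSpace_coe
  let T : E.ker × D.ker →L[ℂ] F := E.ker.subtypeL.coprod D.ker.subtypeL
  have hT : Function.Surjective T := fun f => by
    obtain ⟨g, k, rfl, hg, hk⟩ := h f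
    exact ⟨(⟨g, hg⟩, ⟨k, (hD k).trans hk⟩), by simp [T]⟩
  obtain ⟨M, hM, hpre⟩ := T.exists_preimage_norm_le hT
  refine ⟨M, hM, fun f => ?_⟩
  obtain ⟨⟨⟨g, hg⟩, ⟨k, hk⟩⟩, hgk, hn⟩ := hpre f
  exact ⟨g, k, by simpa [T] using hgk.symm, hg, (hD k).symm.trans hk, hn⟩

end KaltonSpace

/-- Theorem (characterizations of bounded splitting).  For a Kalton space `𝓕` on `U` and `s ∈ U`,
the following are equivalent: (1) `δ_s : ker δ'_s → X_s` is surjective; (2) `𝓕 = ker δ_s + ker δ'_s`;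
(3) the decomposition in (2) can be achieved with control `max {‖g‖, ‖h‖} ≤ M ‖f‖`;
(4) `f'(s) ∈ X_s` for every `f ∈ 𝓕`; (5) `δ'_s : 𝓕 → X_s` is bounded. -/
theorem statement0 (U : Set ℂ) (Sig F : Type*)
    [NormedAddCommGroup Sig] [NormedSpace ℂ Sig] [CompleteSpace Sig]
    [NormedAddCommGroup F] [NormedSpace ℂ F] [CompleteSpace F]
    (K : KaltonSpace U Sig F) (s : ℂ) (hs : s ∈ U) :
    List.TFAE
      [ ∀ x : Sig, K.MemX s x → ∃ f : F, deriv (K.toFun f) s = 0 ∧ K.toFun f s = x,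
        ∀ f : F, ∃ g h : F, f = g + h ∧ K.toFun g s = 0 ∧ deriv (K.toFun h) s = 0,
        ∃ M : ℝ, 0 < M ∧ ∀ f : F, ∃ g h : F, f = g + h ∧ K.toFun g s = 0 ∧
          deriv (K.toFun h) s = 0 ∧ max ‖g‖ ‖h‖ ≤ M * ‖f‖,
        ∀ f : F, K.MemX s (deriv (K.toFun f) s),
        (∀ f : F, K.MemX s (deriv (K.toFun f) s)) ∧
          ∃ C : ℝ, ∀ f : F, K.normX s (deriv (K.toFun f) s) ≤ C * ‖f‖ ] := by
  obtain ⟨φ, hφ, h0⟩ := K.exists_conformalEquivOn_eq_zero hs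
  have hφ' : deriv φ s ≠ 0 := hφ.2.injOn.deriv_ne_zero_of_isOpen K.isOpen hφ.1 hs
  have hsub : ∀ f g : F, deriv (K.toFun (f - g)) s = deriv (K.toFun f) s - deriv (K.toFun g) s :=
    fun f g => by
      rw [map_sub, deriv_sub (K.differentiableAt hs f) (K.differentiableAt hs g)]
  have hadd : ∀ f g : F, deriv (K.toFun (f + g)) s = deriv (K.toFun f) s + deriv (K.toFun g) s :=
    fun f g => by
      rw [map_add, deriv_add (K.differentiableAt hs f) (K.differentiableAt hs g)]
  tfae_have 1 → 2 := fun h f => by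
    obtain ⟨k, hk, hks⟩ := h (K.toFun f s) ⟨f, rfl⟩
    exact ⟨f - k, k, by simp, by simp [hks], hk⟩
  tfae_have 2 → 3 := K.exists_bounded_splitting hs
  tfae_have 3 → 5 := by
    rintro ⟨M, -, h⟩
    have key : ∀ f : F, ∃ k : F, K.toFun k s = deriv (K.toFun f) s ∧
        ‖k‖ ≤ ‖deriv φ s‖ * M * ‖f‖ := by
      intro f
      obtain ⟨g, k, rfl, hg, hk, hn⟩ := h f
      obtain ⟨q, hq, hqn⟩ := K.exists_eq_smul_of_eval_eq_zero hs hφ h0 hg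
      refine ⟨deriv φ s • q, ?_, ?_⟩
      · rw [hadd, hk, add_zero, K.deriv_smul_of_eq_zero hs hφ.1 h0 hq, map_smul, Pi.smul_apply]
      · rw [norm_smul, hqn, mul_assoc]
        exact mul_le_mul_of_nonneg_left ((le_max_left _ _).trans hn) (norm_nonneg _)
    refine ⟨fun f => (key f).imp fun k hk => hk.1, ‖deriv φ s‖ * M, fun f => ?_⟩
    obtain ⟨k, hk, hn⟩ := key f
    exact (K.normX_le hk).trans hn
  tfae_have 5 → 4 := And.left
  tfae_have 4 → 1 := by
    rintro h _ ⟨f, rfl⟩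
    obtain ⟨k, hk⟩ := h f
    obtain ⟨g, hg, -⟩ := K.conf_mul_mem φ hφ ((deriv φ s)⁻¹ • k)
    refine ⟨f - g, ?_, ?_⟩
    · rw [hsub, K.deriv_smul_of_eq_zero hs hφ.1 h0 hg, map_smul, Pi.smul_apply,
        smul_inv_smul₀ hφ', hk, sub_self]
    · rw [map_sub, Pi.sub_apply, hg s hs, h0, zero_smul, sub_zero]
  tfae_finish
end
end

section
/- Let 𝓕 be a Kalton space on U with values in Σ, let s ∈ U, let c ≥ 1 and let B_s be a homogeneous bounded selection for δ_s with constant c, with associated derivation Ω_s = δ'_s ∘ B_s. Then: (i) Ω_s(X_s) ⊆ X_s if and only if f'(s) ∈ X_s for every f ∈ 𝓕; and (ii) Ω_s maps X_s into X_s with ‖Ω_s x‖_s ≤ K‖x‖_s for some constant K and all x ∈ X_s if and only if δ'_s is a bounded operator from 𝓕 to X_s. -/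
open Complex Metric Set

noncomputable section

open Filter Topology in
/-- An injective holomorphic function on an open set has nowhere vanishing derivative. -/
theorem deriv_ne_zero_of_injOn {U : Set ℂ} (hU : IsOpen U) {φ : ℂ → ℂ}
    (hφ : DifferentiableOn ℂ φ U) (hinj : Set.InjOn φ U) {s : ℂ} (hs : s ∈ U) :
    deriv φ s ≠ 0 := by
  have not_const : ∀ z ∈ U, ¬ ∀ᶠ w in 𝓝 z, φ w = φ z := by
    intro z hz h
    have h1 : ∀ᶠ w in 𝓝[≠] z, False := by
      rw [eventually_nhdsWithin_iff]
      filter_upwards [h, hU.mem_nhds hz] with w hw hwU hne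
      exact hne (hinj hwU hz hw)
    exact (h1.exists).elim fun _ h ↦ h
  have nhds_le : ∀ z ∈ U, 𝓝 (φ z) ≤ map φ (𝓝 z) := fun z hz ↦
    ((hφ.analyticAt (hU.mem_nhds hz)).eventually_constant_or_nhds_le_map_nhds).resolve_left
      (not_const z hz)
  have deriv_ne : ∀ᶠ z in 𝓝[≠] s, deriv φ z ≠ 0 := by
    refine ((hφ.analyticAt (hU.mem_nhds hs)).deriv.eventually_eq_zero_or_eventually_ne_zero
      ).resolve_left fun h ↦ ?_
    obtain ⟨r, hr, hball⟩ := Metric.eventually_nhds_iff_ball.1 (h.and (hU.mem_nhds hs))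
    refine not_const s hs ?_
    filter_upwards [Metric.ball_mem_nhds s hr] with w hw
    exact Metric.isOpen_ball.is_const_of_deriv_eq_zero (convex_ball s r).isPreconnected
      (hφ.mono fun z hz ↦ (hball z hz).2) (fun z hz ↦ (hball z hz).1) hw
      (Metric.mem_ball_self hr)
  set ψ := Function.invFunOn φ U
  have left_inv : ∀ z ∈ U, ψ (φ z) = z := fun z hz ↦ hinj.leftInvOn_invFunOn hz
  have left_inv_ev : ∀ z ∈ U, ψ ∘ φ =ᶠ[𝓝 z] id := fun z hz ↦ by
    filter_upwards [hU.mem_nhds hz] with w hw using left_inv w hw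
  have cont : ∀ z ∈ U, ContinuousAt ψ (φ z) := by
    intro z hz
    rw [ContinuousAt, left_inv z hz]
    refine Tendsto.mono_left ?_ (nhds_le z hz)
    rw [tendsto_map'_iff]
    exact tendsto_id.congr' (left_inv_ev z hz).symm
  have diff : ∀ z ∈ U, deriv φ z ≠ 0 → DifferentiableAt ℂ ψ (φ z) := by
    intro z hz hne
    refine (HasDerivAt.of_local_left_inverse (f := φ) (f' := deriv φ z) (cont z hz) ?_ hne
      (nhds_le z hz ?_)).differentiableAt
    · rw [left_inv z hz]
      exact (hφ.differentiableAt (hU.mem_nhds hz)).hasDerivAt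
    · rw [mem_map]
      filter_upwards [hU.mem_nhds hz] with w hw
      exact congrArg φ (left_inv w hw)
  have diff_s : DifferentiableAt ℂ ψ (φ s) := by
    refine (Complex.analyticAt_of_differentiable_on_punctured_nhds_of_continuousAt ?_
      (cont s hs)).differentiableAt
    rw [eventually_nhdsWithin_iff] at deriv_ne ⊢
    refine nhds_le s hs ?_
    rw [mem_map]
    filter_upwards [deriv_ne, hU.mem_nhds hs] with z hz hzU hne
    exact diff z hzU (hz fun h ↦ hne (congrArg φ h))
  intro h0
  have h1 := diff_s.hasDerivAt.comp s (hφ.differentiableAt (hU.mem_nhds hs)).hasDerivAt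
  have h2 := (h1.congr_of_eventuallyEq (left_inv_ev s hs).symm).unique (hasDerivAt_id s)
  simp [h0] at h2

open ComplexConjugate in
/-- For `a` in the unit disc, `w ↦ (w - a) / (1 - conj a * w)` is an automorphism of the disc. -/
theorem conformalEquivOn_moebius {a : ℂ} (ha : a ∈ Metric.ball (0 : ℂ) 1) :
    ConformalEquivOn (fun w ↦ (w - a) / (1 - conj a * w))
      (Metric.ball (0 : ℂ) 1) (Metric.ball (0 : ℂ) 1) := by
  have den_ne : ∀ b w : ℂ, ‖b‖ < 1 → ‖w‖ < 1 → 1 - conj b * w ≠ 0 := by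
    intro b w hb hw h
    have h1 : ‖conj b * w‖ < 1 := by
      rw [norm_mul, RCLike.norm_conj]
      exact mul_lt_one_of_nonneg_of_lt_one_left (norm_nonneg _) hb hw.le
    rw [← sub_eq_zero.1 h] at h1
    simp at h1
  have maps : ∀ b w : ℂ, ‖b‖ < 1 → ‖w‖ < 1 → ‖(w - b) / (1 - conj b * w)‖ < 1 := by
    intro b w hb hw
    rw [norm_div, div_lt_one (norm_pos_iff.2 (den_ne b w hb hw)),
      ← sq_lt_sq₀ (norm_nonneg _) (norm_nonneg _)]
    have hb' : ‖b‖ ^ 2 < 1 := by nlinarith [norm_nonneg b]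
    have hw' : ‖w‖ ^ 2 < 1 := by nlinarith [norm_nonneg w]
    rw [Complex.sq_norm, Complex.normSq_apply] at *
    rw [Complex.sq_norm, Complex.normSq_apply]
    simp only [Complex.sub_re, Complex.sub_im, Complex.mul_re, Complex.mul_im, Complex.one_re,
      Complex.one_im, Complex.conj_re, Complex.conj_im]
    nlinarith [mul_pos (sub_pos.2 hb') (sub_pos.2 hw')]
  have inv : ∀ b w : ℂ, ‖b‖ < 1 → ‖w‖ < 1 →
      ((w - b) / (1 - conj b * w) + b) / (1 + conj b * ((w - b) / (1 - conj b * w))) = w := by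
    intro b w hb hw
    have h1 := den_ne b w hb hw
    have h2 := den_ne b b hb hb
    have e1 : (w - b) / (1 - conj b * w) + b = w * (1 - conj b * b) / (1 - conj b * w) := by
      rw [div_add' _ _ _ h1]
      ring
    have e2 : 1 + conj b * ((w - b) / (1 - conj b * w)) =
        (1 - conj b * b) / (1 - conj b * w) := by
      rw [mul_div_assoc', add_comm, div_add' _ _ _ h1]
      ring
    rw [e1, e2, div_div_div_cancel_right₀ h1, mul_div_cancel_right₀ _ h2]
  simp only [Metric.mem_ball, dist_zero_right] at ha
  refine ⟨?_, Set.InvOn.bijOn (f' := fun w ↦ (w + a) / (1 + conj a * w)) ⟨?_, ?_⟩ ?_ ?_⟩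
  · refine DifferentiableOn.div (by fun_prop) (by fun_prop) fun w hw ↦ ?_
    exact den_ne a w ha (by simpa using hw)
  · intro w hw
    exact inv a w ha (by simpa using hw)
  · intro w hw
    simpa [sub_eq_add_neg] using inv (-a) w (by simpa using ha) (by simpa using hw)
  · intro w hw
    simpa using maps a w ha (by simpa using hw)
  · intro w hw
    simpa [sub_eq_add_neg] using maps (-a) w (by simpa using ha) (by simpa using hw)

theorem ConformalEquivOn.comp {φ χ : ℂ → ℂ} {U V W : Set ℂ} (hχ : ConformalEquivOn χ V W)
    (hφ : ConformalEquivOn φ U V) : ConformalEquivOn (χ ∘ φ) U W :=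
  ⟨hχ.1.comp hφ.1 hφ.2.mapsTo, hχ.2.comp hφ.2⟩

namespace KaltonSpace

variable {U : Set ℂ} {Sig F : Type*}
  [NormedAddCommGroup Sig] [NormedSpace ℂ Sig] [CompleteSpace Sig]
  [NormedAddCommGroup F] [NormedSpace ℂ F] [CompleteSpace F]

theorem exists_conformalEquivOn_apply_eq_zero (K : KaltonSpace U Sig F) {s : ℂ} (hs : s ∈ U) :
    ∃ φ : ℂ → ℂ, ConformalEquivOn φ U (Metric.ball (0 : ℂ) 1) ∧ φ s = 0 := by
  obtain ⟨φ, hφ⟩ := K.conformal_exists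
  exact ⟨_, (conformalEquivOn_moebius (hφ.2.mapsTo hs)).comp hφ, by simp⟩

/-- A function of the Kalton space vanishing at `s` is `φ` times a function of the same norm, where
`φ` is a conformal equivalence vanishing at `s`. -/
theorem exists_deriv_eq_smul (K : KaltonSpace U Sig F) {s : ℂ} (hs : s ∈ U) {φ : ℂ → ℂ}
    (hφ : ConformalEquivOn φ U (Metric.ball (0 : ℂ) 1)) (hφs : φ s = 0) {f : F}
    (hf : K.toFun f s = 0) :
    ∃ h : F, deriv (K.toFun f) s = deriv φ s • K.toFun h s ∧ ‖h‖ = ‖f‖ := by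
  have hU := K.isOpen.mem_nhds hs
  have hd := deriv_ne_zero_of_injOn K.isOpen hφ.1 hφ.2.injOn hs
  have hne : ∀ z ∈ U, dslope φ s z ≠ 0 := by
    intro z hz
    rcases eq_or_ne z s with rfl | hzs
    · rwa [dslope_same]
    · rw [dslope_of_ne _ hzs, slope_def_field, hφs, sub_zero]
      refine div_ne_zero (fun h ↦ hzs (hφ.2.injOn hz hs (h.trans hφs.symm))) (sub_ne_zero.2 hzs)
  obtain ⟨h, hh, hnorm⟩ := K.conf_div_mem φ hφ
    (fun z ↦ (dslope φ s z)⁻¹ • dslope (K.toFun f) s z)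
    ((((Complex.differentiableOn_dslope hU).2 hφ.1).inv hne).smul
      ((Complex.differentiableOn_dslope hU).2 (K.analytic f))) f fun z hz ↦ by
      have e1 := sub_smul_dslope φ s z
      have e2 := sub_smul_dslope (K.toFun f) s z
      rw [hφs, sub_zero, smul_eq_mul] at e1
      rw [hf, sub_zero] at e2
      rw [← e1, ← e2, smul_smul, mul_assoc, mul_inv_cancel₀ (hne z hz), mul_one]
  refine ⟨h, ?_, hnorm⟩
  rw [hh s hs, dslope_same, dslope_same, smul_inv_smul₀ hd]

theorem normX_apply_le (K : KaltonSpace U Sig F) (z : ℂ) (f : F) :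
    K.normX z (K.toFun f z) ≤ ‖f‖ :=
  csInf_le ⟨0, by rintro r ⟨g, -, rfl⟩; exact norm_nonneg g⟩ ⟨f, rfl, rfl⟩

theorem normX_nonneg (K : KaltonSpace U Sig F) (z : ℂ) (x : Sig) : 0 ≤ K.normX z x :=
  Real.sInf_nonneg (by rintro r ⟨g, -, rfl⟩; exact norm_nonneg g)

theorem normX_add_apply_le (K : KaltonSpace U Sig F) {z : ℂ} {x : Sig} (hx : K.MemX z x) (g : F) :
    K.normX z (x + K.toFun g z) ≤ K.normX z x + ‖g‖ := by
  obtain ⟨f₀, hf₀⟩ := hx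
  rw [← sub_le_iff_le_add]
  refine le_csInf ⟨_, f₀, hf₀, rfl⟩ ?_
  rintro r ⟨f, rfl, rfl⟩
  have h := K.normX_apply_le z (f + g)
  rw [map_add, Pi.add_apply] at h
  linarith [norm_add_le f g]

theorem MemX.add_apply {K : KaltonSpace U Sig F} {z : ℂ} {x : Sig} (hx : K.MemX z x) (g : F) :
    K.MemX z (x + K.toFun g z) := by
  obtain ⟨f, rfl⟩ := hx
  exact ⟨f + g, by simp⟩

/-- The derivative at `s` of `f` differs from the derivation applied to `f s` by the value at `s`
of an element of the space with norm controlled by that of `f`. -/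
theorem IsSelection.exists_deriv_eq_add {K : KaltonSpace U Sig F} {s : ℂ} (hs : s ∈ U) {c : ℝ}
    (hc : 1 ≤ c) {B : Sig → F} (hB : K.IsSelection s c B) :
    ∃ M : ℝ, ∀ f : F, ∃ g : F, deriv (K.toFun f) s =
      deriv (K.toFun (B (K.toFun f s))) s + K.toFun g s ∧ ‖g‖ ≤ M * ‖f‖ := by
  obtain ⟨φ, hφ, hφs⟩ := K.exists_conformalEquivOn_apply_eq_zero hs
  refine ⟨‖deriv φ s‖ * (1 + c), fun f ↦ ?_⟩
  have hmem : K.MemX s (K.toFun f s) := ⟨f, rfl⟩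
  set b := B (K.toFun f s)
  obtain ⟨h, hh, hnorm⟩ := K.exists_deriv_eq_smul hs hφ hφs (f := f - b) (by
    rw [map_sub, Pi.sub_apply, hB.2.1 _ hmem, sub_self])
  have hdiff : ∀ k : F, DifferentiableAt ℂ (K.toFun k) s := fun k ↦
    (K.analytic k).differentiableAt (K.isOpen.mem_nhds hs)
  rw [map_sub, deriv_sub (hdiff f) (hdiff b)] at hh
  refine ⟨deriv φ s • h, ?_, ?_⟩
  · rw [map_smul, Pi.smul_apply, ← hh]
    abel
  · have hb : ‖b‖ ≤ c * ‖f‖ := (hB.2.2 _ hmem).trans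
      (mul_le_mul_of_nonneg_left (K.normX_apply_le s f) (by linarith))
    rw [norm_smul, hnorm, mul_assoc]
    gcongr
    linarith [norm_sub_le f b]

end KaltonSpace

/-- For a homogeneous bounded selection `B_s` for `δ_s` with constant `c` and associated
derivation `Ω_s = δ'_s ∘ B_s`: (i) `Ω_s(X_s) ⊆ X_s` iff `f'(s) ∈ X_s` for all `f ∈ 𝓕`;
(ii) `Ω_s : X_s → X_s` is bounded iff `δ'_s : 𝓕 → X_s` is bounded. -/
theorem statement1 (U : Set ℂ) (Sig F : Type*)
    [NormedAddCommGroup Sig] [NormedSpace ℂ Sig] [CompleteSpace Sig]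
    [NormedAddCommGroup F] [NormedSpace ℂ F] [CompleteSpace F]
    (K : KaltonSpace U Sig F) (s : ℂ) (hs : s ∈ U)
    (c : ℝ) (hc : 1 ≤ c) (B : Sig → F) (hB : K.IsSelection s c B) :
    ((∀ x : Sig, K.MemX s x → K.MemX s (deriv (K.toFun (B x)) s)) ↔
      (∀ f : F, K.MemX s (deriv (K.toFun f) s))) ∧
    ((∃ C : ℝ, ∀ x : Sig, K.MemX s x → K.MemX s (deriv (K.toFun (B x)) s) ∧
        K.normX s (deriv (K.toFun (B x)) s) ≤ C * K.normX s x) ↔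
      ((∀ f : F, K.MemX s (deriv (K.toFun f) s)) ∧
        ∃ C : ℝ, ∀ f : F, K.normX s (deriv (K.toFun f) s) ≤ C * ‖f‖)) := by
  obtain ⟨M, hM⟩ := hB.exists_deriv_eq_add hs hc
  have mem_of : (∀ x : Sig, K.MemX s x → K.MemX s (deriv (K.toFun (B x)) s)) →
      ∀ f : F, K.MemX s (deriv (K.toFun f) s) := by
    intro h f
    obtain ⟨g, hg, -⟩ := hM f
    rw [hg]
    exact (h _ ⟨f, rfl⟩).add_apply g
  refine ⟨⟨mem_of, fun h x _ ↦ h (B x)⟩, ?_, ?_⟩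
  · rintro ⟨C, hC⟩
    refine ⟨mem_of fun x hx ↦ (hC x hx).1, |C| + M, fun f ↦ ?_⟩
    obtain ⟨g, hg, hgM⟩ := hM f
    obtain ⟨hmem, hle⟩ := hC (K.toFun f s) ⟨f, rfl⟩
    rw [hg]
    calc _ ≤ K.normX s (deriv (K.toFun (B (K.toFun f s))) s) + ‖g‖ :=
          K.normX_add_apply_le hmem g
      _ ≤ |C| * ‖f‖ + M * ‖f‖ := by
          gcongr
          refine hle.trans (mul_le_mul (le_abs_self C) (K.normX_apply_le s f)
            (K.normX_nonneg _ _) (abs_nonneg C))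
      _ = (|C| + M) * ‖f‖ := by ring
  · rintro ⟨hmem, C, hC⟩
    refine ⟨|C| * c, fun x hx ↦ ⟨hmem _, (hC (B x)).trans ?_⟩⟩
    rw [mul_assoc]
    exact mul_le_mul (le_abs_self C) (hB.2.2 x hx) (norm_nonneg _) (abs_nonneg C)
end
end

section
/- Let 𝓕 be a Kalton space on U with values in Σ, let s, t ∈ U and let n ∈ ℕ ∪ {0}. Define dⁿX_s = 𝓕 / ⋂_{0 ≤ k ≤ n} ker δ_s^{(k)} with the quotient norm, where δ_s^{(k)} f = f^{(k)}(s), and similarly dⁿX_t. Then there exist a complex Banach space Z and linear isometric embeddings i : dⁿX_s → Z and j : dⁿX_t → Z such that the gap between the closed subspaces i(dⁿX_s) and j(dⁿX_t) of Z is at most 4(n+1)·h(s,t); in particular the Kadets distance between dⁿX_s and dⁿX_t is at most 4(n+1)·h(s,t). -/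
open Complex Metric Set

noncomputable section

universe w uS uF

/-- The gap `g(M,N)` between two subsets `M`, `N` of a (semi)normed space, computed with their
closed unit balls `B_M = M ∩ B(0,1)`, `B_N = N ∩ B(0,1)`. -/
def subGap {Z : Type*} [SeminormedAddCommGroup Z] (M N : Set Z) : ℝ :=
  max
    (sSup ((fun x => Metric.infDist x (N ∩ Metric.closedBall 0 1)) '' (M ∩ Metric.closedBall 0 1)))
    (sSup ((fun y => Metric.infDist y (M ∩ Metric.closedBall 0 1)) '' (N ∩ Metric.closedBall 0 1)))

/-- A witness for the bound on the Kadets distance between the derived spaces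
`dⁿX_s = 𝓕 / ⋂_{0 ≤ k ≤ n} ker δ_s^{(k)}` and `dⁿX_t`: a Banach space `Z` together with linear
maps `i, j : 𝓕 → Z` which factor through the corresponding quotients as isometric embeddings
(`‖i f‖` is the quotient norm of the class of `f` in `dⁿX_s`, and similarly for `j`), such that
the gap between the images is at most `bound`. -/
structure DerivedSpaceEmbedding.{w', uS', uF'} {U : Set ℂ} {Sig : Type uS'} {F : Type uF'}
    [NormedAddCommGroup Sig] [NormedSpace ℂ Sig] [CompleteSpace Sig]
    [NormedAddCommGroup F] [NormedSpace ℂ F] [CompleteSpace F]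
    (K : KaltonSpace U Sig F) (s t : ℂ) (n : ℕ) (bound : ℝ) where
  Z : Type w'
  [normedZ : NormedAddCommGroup Z]
  [normedSpaceZ : NormedSpace ℂ Z]
  [completeZ : CompleteSpace Z]
  i : F →ₗ[ℂ] Z
  j : F →ₗ[ℂ] Z
  norm_i : ∀ f : F, ‖i f‖ =
    sInf {r : ℝ | ∃ g : F, (∀ k ≤ n, iteratedDeriv k (K.toFun g) s = 0) ∧ r = ‖f + g‖}
  norm_j : ∀ f : F, ‖j f‖ =
    sInf {r : ℝ | ∃ g : F, (∀ k ≤ n, iteratedDeriv k (K.toFun g) t = 0) ∧ r = ‖f + g‖}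
  gap_le : subGap (Set.range i) (Set.range j) ≤ bound

/-- Every seminormed space modulo a subspace maps isometrically, for the quotient seminorm, into a
Banach space. -/
theorem exists_banach_quotient_seminorm {E : Type w} [AddCommGroup E] [Module ℂ E]
    (p : Seminorm ℂ E) (L : Submodule ℂ E) :
    ∃ (Z : Type w) (_ : NormedAddCommGroup Z) (_ : NormedSpace ℂ Z) (_ : CompleteSpace Z)
      (T : E →ₗ[ℂ] Z), (∀ x, ∀ l ∈ L, ‖T x‖ ≤ p (x + l)) ∧
        ∀ x r, (∀ l ∈ L, r ≤ p (x + l)) → r ≤ ‖T x‖ := by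
  let : SeminormedAddCommGroup E := p.toAddGroupSeminorm.toSeminormedAddCommGroup
  let : NormedSpace ℂ E := ⟨fun a b => (map_smul_eq_mul p a b).le⟩
  have hp : ∀ x : E, ‖x‖ = p x := fun _ => rfl
  refine ⟨UniformSpace.Completion (E ⧸ L), inferInstance, inferInstance, inferInstance,
    (UniformSpace.Completion.toComplL (𝕜 := ℂ) (E := E ⧸ L)).toLinearMap ∘ₗ L.mkQ, ?_, ?_⟩
  · intro x l hl
    have h : L.mkQ x = Submodule.Quotient.mk (x + l) := by
      rw [Submodule.mkQ_apply, Submodule.Quotient.eq]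
      simpa using hl
    simp only [LinearMap.comp_apply, h]
    simpa [← hp] using Submodule.Quotient.norm_mk_le (S := L) (x + l)
  · intro x r hr
    refine le_of_forall_pos_le_add fun η hη => ?_
    obtain ⟨m, hm, hlt⟩ := Submodule.Quotient.norm_mk_lt (L.mkQ x) hη
    have hl : m - x ∈ L := by
      rwa [Submodule.mkQ_apply, Submodule.Quotient.eq] at hm
    have := hr _ hl
    rw [add_sub_cancel, ← hp] at this
    simpa using this.trans hlt.le

/-- If every `m ∈ M` is `d‖m‖`-close to `N` and vice versa, the quotients by `M` and `N` embed
isometrically in a common Banach space so that the two classes of `f` are `2d‖f‖`-close. -/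
theorem exists_common_embedding_of_quotients {F : Type w} [SeminormedAddCommGroup F]
    [NormedSpace ℂ F] (M N : Submodule ℂ F) {d : ℝ} (hd : 0 ≤ d)
    (hMN : ∀ m ∈ M, ∃ n ∈ N, ‖m - n‖ ≤ d * ‖m‖) (hNM : ∀ n ∈ N, ∃ m ∈ M, ‖n - m‖ ≤ d * ‖n‖) :
    ∃ (Z : Type w) (_ : NormedAddCommGroup Z) (_ : NormedSpace ℂ Z) (_ : CompleteSpace Z)
      (i j : F →ₗ[ℂ] Z),
      (∀ f, IsGLB {r : ℝ | ∃ g, g ∈ M ∧ r = ‖f + g‖} ‖i f‖) ∧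
      (∀ f, IsGLB {r : ℝ | ∃ g, g ∈ N ∧ r = ‖f + g‖} ‖j f‖) ∧
      ∀ f, ‖i f - j f‖ ≤ 2 * d * ‖f‖ := by
  let q : Seminorm ℂ (F × F × F) :=
    (normSeminorm ℂ F).comp (.fst ℂ F (F × F)) +
      (normSeminorm ℂ F).comp (.fst ℂ F F ∘ₗ .snd ℂ F (F × F)) +
      (2 * d).toNNReal •
        (normSeminorm ℂ F).comp (.snd ℂ F F ∘ₗ .snd ℂ F (F × F))
  have hq : ∀ a b c, q (a, b, c) = ‖a‖ + ‖b‖ + 2 * d * ‖c‖ := fun _ _ _ => by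
    simp [q, NNReal.smul_def, hd]
  let L : Submodule ℂ (F × F × F) :=
    M.comap (.fst ℂ F (F × F) + .snd ℂ F F ∘ₗ .snd ℂ F (F × F)) ⊓
      N.comap (.fst ℂ F F ∘ₗ .snd ℂ F (F × F) - .snd ℂ F F ∘ₗ .snd ℂ F (F × F))
  have hL : ∀ a b c, (a, b, c) ∈ L ↔ a + c ∈ M ∧ b - c ∈ N := fun _ _ _ => Iff.rfl
  have key : ∀ (P Q : Submodule ℂ F), (∀ n ∈ Q, ∃ m ∈ P, ‖n - m‖ ≤ d * ‖n‖) →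
      ∀ c, ∀ n ∈ Q, ∃ m ∈ P, ‖c + m‖ ≤ ‖c + n‖ + 2 * d * ‖c‖ := by
    intro P Q h c n hn
    by_cases hc : ‖n‖ ≤ 2 * ‖c‖
    · obtain ⟨m, hm, hle⟩ := h n hn
      refine ⟨m, hm, ?_⟩
      have h1 : ‖c + m‖ ≤ ‖c + n‖ + ‖n - m‖ := by
        rw [show c + m = c + n - (n - m) by abel]
        exact norm_sub_le _ _
      nlinarith [mul_le_mul_of_nonneg_left hc hd]
    · refine ⟨0, P.zero_mem, ?_⟩
      have h1 : ‖n‖ ≤ ‖c + n‖ + ‖c‖ := by simpa using norm_sub_le (c + n) c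
      have : 0 ≤ 2 * d * ‖c‖ := by positivity
      rw [add_zero]
      linarith
  obtain ⟨Z, z1, z2, z3, T, hT1, hT2⟩ := exists_banach_quotient_seminorm q L
  refine ⟨Z, z1, z2, z3, T ∘ₗ .inl ℂ F (F × F), T ∘ₗ .inr ℂ F (F × F) ∘ₗ .inl ℂ F F,
    fun f => ⟨?_, ?_⟩, fun f => ⟨?_, ?_⟩, fun f => ?_⟩
  · rintro r ⟨g, hg, rfl⟩
    simpa [hq, ← Prod.zero_eq_mk] using hT1 (f, 0, 0) (g, 0, 0) ((hL _ _ _).2 (by simpa using hg))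
  · intro r hr
    refine hT2 (f, 0, 0) r ?_
    rintro ⟨a, b, c⟩ hl
    obtain ⟨h1, h2⟩ := (hL _ _ _).1 hl
    obtain ⟨m, hm, hle⟩ := key M N hNM c _ h2
    have h3 := hr ⟨a + c + m, M.add_mem h1 hm, rfl⟩
    have h4 : ‖f + (a + c + m)‖ ≤ ‖f + a‖ + ‖c + m‖ := by
      simpa [add_assoc] using norm_add_le (f + a) (c + m)
    simp only [Prod.mk_add_mk, hq, zero_add]
    rw [add_sub_cancel] at hle
    linarith
  · rintro r ⟨g, hg, rfl⟩
    simpa [hq] using hT1 (0, f, 0) (0, g, 0) ((hL _ _ _).2 (by simpa using hg))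
  · intro r hr
    refine hT2 (0, f, 0) r ?_
    rintro ⟨a, b, c⟩ hl
    obtain ⟨h1, h2⟩ := (hL _ _ _).1 hl
    obtain ⟨m, hm, hle⟩ := key N M hMN (-c) _ h1
    have h3 := hr ⟨b - c + m, N.add_mem h2 hm, rfl⟩
    have h4 : ‖f + (b - c + m)‖ ≤ ‖f + b‖ + ‖-c + m‖ := by
      rw [show f + (b - c + m) = f + b + (-c + m) by abel]
      exact norm_add_le _ _
    simp only [Prod.mk_add_mk, hq, zero_add]
    rw [neg_add_cancel_comm_assoc, norm_neg] at hle
    linarith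
  · have h := hT1 (f, -f, 0) (-f, f, f) ((hL _ _ _).2 (by simp))
    have h2 : T (f, -f, 0) = T (f, 0, 0) - T (0, f, 0) := by rw [← map_sub]; simp
    rw [h2] at h
    simpa [hq, ← Prod.zero_eq_mk] using h

theorem infDist_range_inter_closedBall_le {F Z : Type*} [SeminormedAddCommGroup F]
    [NormedSpace ℂ F] [NormedAddCommGroup Z] [NormedSpace ℂ Z] (i j : F →ₗ[ℂ] Z) (M : Submodule ℂ F)
    {ε : ℝ} (hε : 0 ≤ ε) (hi : ∀ f, IsGLB {r : ℝ | ∃ g, g ∈ M ∧ r = ‖f + g‖} ‖i f‖)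
    (hj : ∀ f, ‖j f‖ ≤ ‖f‖) (hij : ∀ f, ‖i f - j f‖ ≤ ε * ‖f‖) {x : Z}
    (hx : x ∈ range i ∩ closedBall 0 1) : infDist x (range j ∩ closedBall 0 1) ≤ ε := by
  obtain ⟨⟨f, rfl⟩, hx⟩ := hx
  rw [mem_closedBall_zero_iff] at hx
  refine le_of_forall_pos_le_add fun η hη => ?_
  obtain ⟨_, ⟨g, hg, rfl⟩, -, hlt⟩ := (hi f).exists_between (show ‖i f‖ < 1 + η by linarith)
  have hig : i g = 0 := by
    refine norm_le_zero_iff.1 ((hi g).1 ⟨-g, M.neg_mem hg, ?_⟩)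
    simp
  have hfg : i f = i (f + g) := by rw [map_add, hig, add_zero]
  set h := f + g
  have hpos : 0 < 1 + η := by positivity
  have hmem : ((1 + η : ℝ) : ℂ)⁻¹ • j h ∈ range j ∩ closedBall 0 1 := by
    refine ⟨⟨((1 + η : ℝ) : ℂ)⁻¹ • h, map_smul _ _ _⟩, ?_⟩
    rw [mem_closedBall_zero_iff, norm_smul, norm_inv, Complex.norm_of_nonneg hpos.le,
      inv_mul_le_one₀ hpos]
    exact (hj h).trans hlt.le
  refine (infDist_le_dist_of_mem hmem).trans ?_
  have hdecomp : i f - ((1 + η : ℝ) : ℂ)⁻¹ • j h =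
      ((1 + η : ℝ) : ℂ)⁻¹ • ((i h - j h) + (η : ℂ) • i f) := by
    have hne : ((1 + η : ℝ) : ℂ) ≠ 0 := by exact_mod_cast hpos.ne'
    rw [eq_inv_smul_iff₀ hne, smul_sub, smul_inv_smul₀ hne, ← hfg]
    push_cast
    module
  rw [dist_eq_norm, hdecomp, norm_smul, norm_inv, Complex.norm_of_nonneg hpos.le,
    inv_mul_le_iff₀ hpos]
  have h1 := norm_add_le (i h - j h) ((η : ℂ) • i f)
  rw [norm_smul, Complex.norm_of_nonneg hη.le] at h1
  nlinarith [hij h, mul_le_mul_of_nonneg_left hlt.le hε, mul_le_mul_of_nonneg_left hx hη.le]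

open Filter Topology in
/-- An injective holomorphic function vanishes only to first order. -/
theorem analyticOrderAt_eq_one_of_injOn {U : Set ℂ} (hU : IsOpen U) {φ : ℂ → ℂ}
    (hd : DifferentiableOn ℂ φ U) (hinj : InjOn φ U) {s : ℂ} (hs : s ∈ U) (h0 : φ s = 0) :
    analyticOrderAt φ s = 1 := by
  have hUs : U ∈ 𝓝 s := hU.mem_nhds hs
  have han : AnalyticAt ℂ φ s := hd.analyticAt hUs
  have htop : analyticOrderAt φ s ≠ ⊤ := by
    rw [Ne, analyticOrderAt_eq_top]
    intro h
    obtain ⟨z, ⟨hz, hzU⟩, hzs⟩ :=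
      ((h.and hUs).filter_mono nhdsWithin_le_nhds |>.and
        (self_mem_nhdsWithin (s := {s}ᶜ))).exists
    exact hzs (hinj hzU hs (hz.trans h0.symm))
  obtain ⟨m, hm⟩ := ENat.ne_top_iff_exists.1 htop
  obtain ⟨u, hu, hu0, hφu⟩ := han.analyticOrderAt_eq_natCast.1 hm.symm
  have hm0 : m ≠ 0 := by
    rintro rfl
    exact han.analyticOrderAt_ne_zero.2 h0 hm.symm
  rw [← hm]
  by_contra hm1
  have hm1 : 1 < m := by
    have : m ≠ 1 := fun h => hm1 (by simp [h])
    omega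
  let v : ℂ → ℂ := fun z => (u z / u s) ^ ((m : ℂ)⁻¹)
  have hvs : v s = 1 := by simp [v, hu0]
  have hv : AnalyticAt ℂ v s :=
    (hu.div_const).cpow analyticAt_const (by simp [hu0])
  have hvm : ∀ z, u z = u s * v z ^ m := fun z => by
    simp only [v]
    rw [Complex.cpow_nat_inv_pow _ hm0, mul_div_cancel₀ _ hu0]
  let ψ : ℂ → ℂ := fun z => (z - s) * v z
  have hψ : AnalyticAt ℂ ψ s := (analyticAt_id.sub analyticAt_const).mul hv
  have hψs : ψ s = 0 := by simp [ψ]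
  have hder : HasStrictDerivAt ψ 1 s := by
    have h1 := ((hasDerivAt_id s).sub_const s).mul hv.differentiableAt.hasDerivAt
    have h2 : deriv ψ s = 1 := by
      rw [show ψ = (fun x => id x - s) * v from rfl, h1.deriv]
      simp [hvs]
    exact h2 ▸ hψ.hasStrictDerivAt
  let g := hder.localInverse ψ 1 s one_ne_zero
  have hg : ∀ᶠ w in 𝓝 (0 : ℂ), ψ (g w) = w :=
    hψs ▸ hder.eventually_right_inverse one_ne_zero
  have hg0 : g 0 = s := hψs ▸ (hder.eventually_left_inverse one_ne_zero).self_of_nhds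
  have hgc : Tendsto g (𝓝 0) (𝓝 s) := by
    have := (hder.to_localInverse one_ne_zero).hasDerivAt.continuousAt.tendsto
    rw [hψs] at this
    exact hg0 ▸ this
  have hgood : ∀ᶠ w in 𝓝 (0 : ℂ), g w ∈ U ∧ φ (g w) = u s * w ^ m := by
    filter_upwards [hg, hgc.eventually hUs, hgc.eventually hφu] with w h1 h2 h3
    refine ⟨h2, ?_⟩
    rw [h3, hvm, smul_eq_mul, mul_left_comm, ← mul_pow]
    exact congrArg (fun x => u s * x ^ m) h1
  have hζ := Complex.isPrimitiveRoot_exp m hm0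
  set ζ := Complex.exp (2 * Real.pi * Complex.I / m)
  have hζc : Tendsto (fun w : ℂ => ζ * w) (𝓝 0) (𝓝 0) := by
    have : Continuous fun w : ℂ => ζ * w := by fun_prop
    simpa using this.tendsto 0
  obtain ⟨w, ⟨⟨⟨⟨hw1, hw2⟩, hw3⟩, ⟨hw4, hw5⟩⟩, hw6⟩, hw7⟩ :=
    ((((hgood.and hg).and (hζc.eventually hgood)).and (hζc.eventually hg)).filter_mono
      nhdsWithin_le_nhds |>.and (self_mem_nhdsWithin (s := {(0 : ℂ)}ᶜ))).exists
  have h1 : g (ζ * w) = g w :=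
    hinj hw4 hw1 (by rw [hw5, hw2, mul_pow, hζ.pow_eq_one, one_mul])
  rw [h1, hw3] at hw6
  exact hζ.ne_one hm1 (mul_right_cancel₀ hw7 (by rw [← hw6, one_mul]))

theorem one_sub_conj_mul_ne_zero_s2 {a w : ℂ} (ha : a ∈ ball (0 : ℂ) 1) (hw : w ∈ ball (0 : ℂ) 1) :
    1 - (starRingEnd ℂ) a * w ≠ 0 := by
  intro h
  rw [mem_ball_zero_iff] at ha hw
  have h1 : ‖(starRingEnd ℂ) a * w‖ = 1 := by rw [← sub_eq_zero.1 h, norm_one]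
  rw [norm_mul, Complex.norm_conj] at h1
  nlinarith [norm_nonneg a, norm_nonneg w]

/-- The conformal equivalence `(φ - a) / (1 - ā φ)` obtained by following `φ` with a disc
automorphism. -/
theorem ConformalEquivOn.mobius {U : Set ℂ} {φ : ℂ → ℂ} (hφ : ConformalEquivOn φ U (ball 0 1))
    {a : ℂ} (ha : a ∈ ball (0 : ℂ) 1) :
    ConformalEquivOn (fun z => (φ z - a) / (1 - (starRingEnd ℂ) a * φ z)) U (ball 0 1) := by
  have hmaps : ∀ {b : ℂ}, b ∈ ball (0 : ℂ) 1 →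
      MapsTo (fun w => (w - b) / (1 - (starRingEnd ℂ) b * w)) (ball 0 1) (ball 0 1) := by
    intro b hb w hw
    have h0 := one_sub_conj_mul_ne_zero_s2 hb hw
    rw [mem_ball_zero_iff] at *
    rw [norm_div, div_lt_one (norm_pos_iff.2 h0)]
    refine lt_of_pow_lt_pow_left₀ 2 (norm_nonneg _) ?_
    rw [← Complex.normSq_eq_norm_sq, ← Complex.normSq_eq_norm_sq]
    have hb' : Complex.normSq b < 1 := by
      rw [Complex.normSq_eq_norm_sq]; nlinarith [norm_nonneg b]
    have hw' : Complex.normSq w < 1 := by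
      rw [Complex.normSq_eq_norm_sq]; nlinarith [norm_nonneg w]
    simp only [Complex.normSq_apply, Complex.sub_re, Complex.sub_im, Complex.one_re, Complex.one_im,
      Complex.mul_re, Complex.mul_im, Complex.conj_re, Complex.conj_im] at *
    nlinarith [mul_pos (sub_pos.2 hb') (sub_pos.2 hw')]
  have hleft : ∀ {b : ℂ}, b ∈ ball (0 : ℂ) 1 → LeftInvOn
      (fun w => (w - -b) / (1 - (starRingEnd ℂ) (-b) * w))
      (fun w => (w - b) / (1 - (starRingEnd ℂ) b * w)) (ball 0 1) := by
    intro b hb w hw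
    have h1 := one_sub_conj_mul_ne_zero_s2 hb hw
    have h2 := one_sub_conj_mul_ne_zero_s2 (a := -b) (by simpa using hb) (hmaps hb hw)
    have h3 := one_sub_conj_mul_ne_zero_s2 hb hb
    simp only at h2 ⊢
    rw [div_eq_iff h2]
    simp only [map_neg]
    rw [mul_comm] at h1
    field_simp
    ring
  have ha' : -a ∈ ball (0 : ℂ) 1 := by simpa using ha
  have hinv : InvOn (fun w => (w - -a) / (1 - (starRingEnd ℂ) (-a) * w))
      (fun w => (w - a) / (1 - (starRingEnd ℂ) a * w)) (ball 0 1) (ball 0 1) :=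
    ⟨hleft ha, by simpa using hleft ha'⟩
  refine ⟨?_, (hinv.bijOn (hmaps ha) (hmaps ha')).comp hφ.2⟩
  refine (hφ.1.sub_const a).div ((differentiableOn_const 1).sub (hφ.1.const_mul _)) fun z hz => ?_
  exact one_sub_conj_mul_ne_zero_s2 ha (hφ.2.mapsTo hz)

namespace KaltonSpace

open Filter Topology

section

variable {U : Set ℂ} {Sig : Type uS} {F : Type uF}
  [NormedAddCommGroup Sig] [NormedSpace ℂ Sig] [CompleteSpace Sig]
  [NormedAddCommGroup F] [NormedSpace ℂ F] [CompleteSpace F]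

/-- Multiplication by a conformal equivalence of `U` onto the disc, as an isometry of `F`. -/
def mulBy (K : KaltonSpace U Sig F) {φ : ℂ → ℂ} (hφ : ConformalEquivOn φ U (ball 0 1)) :
    F →ₗᵢ[ℂ] F where
  toFun f := (K.conf_mul_mem φ hφ f).choose
  map_add' f g := K.inj _ _ fun z hz => by
    refine ((K.conf_mul_mem φ hφ (f + g)).choose_spec.1 z hz).trans ?_
    simp only [map_add, Pi.add_apply, smul_add]
    rw [(K.conf_mul_mem φ hφ f).choose_spec.1 z hz, (K.conf_mul_mem φ hφ g).choose_spec.1 z hz]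
  map_smul' c f := K.inj _ _ fun z hz => by
    refine ((K.conf_mul_mem φ hφ (c • f)).choose_spec.1 z hz).trans ?_
    simp only [map_smul, Pi.smul_apply, RingHom.id_apply]
    rw [(K.conf_mul_mem φ hφ f).choose_spec.1 z hz, smul_comm]
  norm_map' f := (K.conf_mul_mem φ hφ f).choose_spec.2

variable (K : KaltonSpace U Sig F) {φ : ℂ → ℂ} (hφ : ConformalEquivOn φ U (ball 0 1))

theorem toFun_mulBy (f : F) {z : ℂ} (hz : z ∈ U) :
    K.toFun (K.mulBy hφ f) z = φ z • K.toFun f z :=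
  (K.conf_mul_mem φ hφ f).choose_spec.1 z hz

theorem analyticAt (f : F) {z : ℂ} (hz : z ∈ U) : AnalyticAt ℂ (K.toFun f) z :=
  (K.analytic f).analyticAt (K.isOpen.mem_nhds hz)

variable {s : ℂ} (hs : s ∈ U) (hφs : φ s = 0)
include K hφ hs hφs

theorem deriv_conformal_ne_zero : deriv φ s ≠ 0 := by
  intro h
  have han : AnalyticAt ℂ φ s := hφ.1.analyticAt (K.isOpen.mem_nhds hs)
  have h2 : ((2 : ℕ) : ℕ∞) ≤ analyticOrderAt φ s := by
    rw [natCast_le_analyticOrderAt_iff_iteratedDeriv_eq_zero han]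
    intro i hi
    interval_cases i <;> simp [h, hφs]
  rw [analyticOrderAt_eq_one_of_injOn K.isOpen hφ.1 hφ.2.injOn hs hφs] at h2
  exact absurd h2 (by decide)

theorem exists_mulBy_eq {g : F} (hg : K.toFun g s = 0) : ∃ f, K.mulBy hφ f = g := by
  have hUs := K.isOpen.mem_nhds hs
  have hne : ∀ z ∈ U, dslope φ s z ≠ 0 := by
    intro z hz
    rcases eq_or_ne z s with rfl | hzs
    · rw [dslope_same]
      exact K.deriv_conformal_ne_zero hφ hs hφs
    · intro h
      have := sub_smul_dslope φ s z
      rw [h, smul_zero] at this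
      exact hzs (hφ.2.injOn hz hs (sub_eq_zero.1 this.symm))
  have hdiff : DifferentiableOn ℂ (fun z => (dslope φ s z)⁻¹ • dslope (K.toFun g) s z) U :=
    (((differentiableOn_dslope hUs).2 hφ.1).inv hne).smul
      ((differentiableOn_dslope hUs).2 (K.analytic g))
  have hfac : ∀ z ∈ U, K.toFun g z = φ z • (dslope φ s z)⁻¹ • dslope (K.toFun g) s z := by
    intro z hz
    have h1 := sub_smul_dslope φ s z
    have h2 := sub_smul_dslope (K.toFun g) s z
    rw [hφs, sub_zero, smul_eq_mul] at h1
    rw [hg, sub_zero] at h2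
    rw [← h1, smul_smul, mul_assoc, mul_inv_cancel₀ (hne z hz), mul_one, h2]
  obtain ⟨f, hf, -⟩ := K.conf_div_mem φ hφ _ hdiff g hfac
  exact ⟨f, K.inj _ _ fun z hz => by rw [K.toFun_mulBy hφ f hz, hf z hz, hfac z hz]⟩

theorem analyticOrderAt_mulBy (f : F) :
    analyticOrderAt (K.toFun (K.mulBy hφ f)) s = 1 + analyticOrderAt (K.toFun f) s := by
  have hUs := K.isOpen.mem_nhds hs
  have h : K.toFun (K.mulBy hφ f) =ᶠ[𝓝 s] φ • K.toFun f := by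
    filter_upwards [hUs] with z hz using K.toFun_mulBy hφ f hz
  rw [analyticOrderAt_congr h, analyticOrderAt_smul (hφ.1.analyticAt hUs) (K.analyticAt f hs),
    analyticOrderAt_eq_one_of_injOn K.isOpen hφ.1 hφ.2.injOn hs hφs]

theorem mem_range_mulBy_pow (m : ℕ) (g : F) :
    g ∈ LinearMap.range ((K.mulBy hφ).toLinearMap ^ m) ↔
      (m : ℕ∞) ≤ analyticOrderAt (K.toFun g) s := by
  induction m generalizing g with
  | zero => simp
  | succ m ih =>
    have hsucc : g ∈ LinearMap.range ((K.mulBy hφ).toLinearMap ^ (m + 1)) ↔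
        ∃ f ∈ LinearMap.range ((K.mulBy hφ).toLinearMap ^ m), K.mulBy hφ f = g := by
      simp [pow_succ']
    have hcast : ∀ f, ((m + 1 : ℕ) : ℕ∞) ≤ analyticOrderAt (K.toFun (K.mulBy hφ f)) s ↔
        (m : ℕ∞) ≤ analyticOrderAt (K.toFun f) s := by
      intro f
      rw [K.analyticOrderAt_mulBy hφ hs hφs, add_comm m, ENat.natCast_add, Nat.cast_one]
      exact ENat.add_le_add_iff_left ENat.one_ne_top
    rw [hsucc]
    constructor
    · rintro ⟨f, hf, rfl⟩
      exact (hcast f).2 ((ih f).1 hf)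
    · intro h
      have hg : K.toFun g s = 0 :=
        apply_eq_zero_of_analyticOrderAt_ne_zero fun h0 => by simp [h0] at h
      obtain ⟨f, rfl⟩ := K.exists_mulBy_eq hφ hs hφs hg
      exact ⟨f, (ih f).2 ((hcast f).1 h), rfl⟩

theorem mem_range_mulBy_pow_succ_iff_iteratedDeriv (n : ℕ) (g : F) :
    g ∈ LinearMap.range ((K.mulBy hφ).toLinearMap ^ (n + 1)) ↔
      ∀ k ≤ n, iteratedDeriv k (K.toFun g) s = 0 := by
  rw [K.mem_range_mulBy_pow hφ hs hφs,
    natCast_le_analyticOrderAt_iff_iteratedDeriv_eq_zero (K.analyticAt g hs)]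
  simp only [Nat.lt_succ_iff]

end

end KaltonSpace

theorem LinearIsometry.norm_pow_apply {F : Type*} [SeminormedAddCommGroup F] [NormedSpace ℂ F]
    (A : F →ₗᵢ[ℂ] F) (m : ℕ) (f : F) : ‖(A.toLinearMap ^ m) f‖ = ‖f‖ := by
  induction m with
  | zero => simp
  | succ m ih => rw [pow_succ', Module.End.mul_apply]; simpa using ih

/-- Powers of two isometries that are `c`-close are `mc`-close. -/
theorem LinearIsometry.norm_pow_sub_pow_le {F : Type*} [SeminormedAddCommGroup F] [NormedSpace ℂ F]
    (A B : F →ₗᵢ[ℂ] F) {c : ℝ} (h : ∀ f, ‖A f - B f‖ ≤ c * ‖f‖) (m : ℕ) (f : F) :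
    ‖(A.toLinearMap ^ m) f - (B.toLinearMap ^ m) f‖ ≤ m * c * ‖f‖ := by
  induction m with
  | zero => simp
  | succ m ih =>
    have h1 : (A.toLinearMap ^ (m + 1)) f - (B.toLinearMap ^ (m + 1)) f =
        A ((A.toLinearMap ^ m) f - (B.toLinearMap ^ m) f) +
          (A ((B.toLinearMap ^ m) f) - B ((B.toLinearMap ^ m) f)) := by
      simp [pow_succ']
    rw [h1]
    refine (norm_add_le _ _).trans ?_
    have h2 := h ((B.toLinearMap ^ m) f)
    rw [B.norm_pow_apply] at h2
    rw [A.norm_map]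
    push_cast
    linarith

/-- If `ψ` is `φ` followed by the disc automorphism sending `a` to `0`, then
`φ - ψ = a - ā φ ψ`, so multiplications by `φ` and `ψ` differ by at most `2|a|`. -/
theorem KaltonSpace.norm_mulBy_sub_mulBy_mobius_le {U : Set ℂ} {Sig : Type uS} {F : Type uF}
    [NormedAddCommGroup Sig] [NormedSpace ℂ Sig] [CompleteSpace Sig]
    [NormedAddCommGroup F] [NormedSpace ℂ F] [CompleteSpace F] (K : KaltonSpace U Sig F)
    {φ : ℂ → ℂ} (hφ : ConformalEquivOn φ U (ball 0 1)) {a : ℂ} (ha : a ∈ ball (0 : ℂ) 1) (f : F) :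
    ‖K.mulBy hφ f - K.mulBy (hφ.mobius ha) f‖ ≤ 2 * ‖a‖ * ‖f‖ := by
  have hid : K.mulBy hφ f - K.mulBy (hφ.mobius ha) f =
      a • f - (starRingEnd ℂ) a • K.mulBy hφ (K.mulBy (hφ.mobius ha) f) := by
    refine K.inj _ _ fun z hz => ?_
    simp only [map_sub, map_smul, Pi.sub_apply, Pi.smul_apply, K.toFun_mulBy _ _ hz, smul_smul,
      ← sub_smul]
    congr 1
    have hne : 1 - (starRingEnd ℂ) a * φ z ≠ 0 := one_sub_conj_mul_ne_zero_s2 ha (hφ.2.mapsTo hz)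
    rw [mul_comm] at hne
    field_simp
    ring
  rw [hid]
  refine (norm_sub_le _ _).trans_eq ?_
  rw [norm_smul, norm_smul, Complex.norm_conj, LinearIsometry.norm_map, LinearIsometry.norm_map]
  ring

/-- The Kadets distance between the derived spaces `dⁿX_s` and `dⁿX_t` is at most
`4(n+1)·h(s,t)`, where `h(s,t) = |φ_s(t)|` is the pseudo-hyperbolic distance: there exist a
Banach space `Z` and isometric linear embeddings of `dⁿX_s` and `dⁿX_t` into `Z` whose images
have gap at most `4(n+1)·h(s,t)`. -/
theorem statement2 (U : Set ℂ) (Sig : Type uS) (F : Type uF)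
    [NormedAddCommGroup Sig] [NormedSpace ℂ Sig] [CompleteSpace Sig]
    [NormedAddCommGroup F] [NormedSpace ℂ F] [CompleteSpace F]
    (K : KaltonSpace U Sig F) (s t : ℂ) (hs : s ∈ U) (ht : t ∈ U) (n : ℕ)
    (φs : ℂ → ℂ) (hφ : ConformalEquivOn φs U (Metric.ball (0 : ℂ) 1)) (hφs : φs s = 0) :
    Nonempty (DerivedSpaceEmbedding.{uF, uS, uF} K s t n (4 * (n + 1 : ℝ) * ‖φs t‖)) := by
  have ha : φs t ∈ ball (0 : ℂ) 1 := hφ.2.mapsTo ht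
  set a := φs t with hadef
  let A := K.mulBy hφ
  let B := K.mulBy (hφ.mobius ha)
  have hc : ∀ f, ‖A f - B f‖ ≤ 2 * ‖a‖ * ‖f‖ := K.norm_mulBy_sub_mulBy_mobius_le hφ ha
  have hd : (0 : ℝ) ≤ (n + 1 : ℕ) * (2 * ‖a‖) := by positivity
  obtain ⟨Z, z1, z2, z3, i, j, hi, hj, hij⟩ := exists_common_embedding_of_quotients
    (LinearMap.range (A.toLinearMap ^ (n + 1))) (LinearMap.range (B.toLinearMap ^ (n + 1))) hd
    (by
      rintro _ ⟨f, rfl⟩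
      refine ⟨_, ⟨f, rfl⟩, ?_⟩
      rw [A.norm_pow_apply]
      exact A.norm_pow_sub_pow_le B hc _ f)
    (by
      rintro _ ⟨f, rfl⟩
      refine ⟨_, ⟨f, rfl⟩, ?_⟩
      rw [B.norm_pow_apply, norm_sub_rev]
      exact A.norm_pow_sub_pow_le B hc _ f)
  have hbound : 2 * ((n + 1 : ℕ) * (2 * ‖a‖)) = 4 * (n + 1 : ℝ) * ‖a‖ := by
    push_cast
    ring
  rw [hbound] at hij
  have hε : 0 ≤ 4 * (n + 1 : ℝ) * ‖a‖ := by positivity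
  have hi1 : ∀ f, ‖i f‖ ≤ ‖f‖ := fun f => (hi f).1 ⟨0, Submodule.zero_mem _, by simp⟩
  have hj1 : ∀ f, ‖j f‖ ≤ ‖f‖ := fun f => (hj f).1 ⟨0, Submodule.zero_mem _, by simp⟩
  refine ⟨{ Z := Z, i := i, j := j, norm_i := fun f => ?_, norm_j := fun f => ?_, gap_le := ?_ }⟩
  · simp only [← K.mem_range_mulBy_pow_succ_iff_iteratedDeriv hφ hs hφs]
    exact ((hi f).csInf_eq ⟨_, 0, Submodule.zero_mem _, rfl⟩).symm
  · simp only [← K.mem_range_mulBy_pow_succ_iff_iteratedDeriv (hφ.mobius ha) ht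
      (by simp [hadef])]
    exact ((hj f).csInf_eq ⟨_, 0, Submodule.zero_mem _, rfl⟩).symm
  · refine max_le (Real.sSup_le ?_ hε) (Real.sSup_le ?_ hε)
    · rintro _ ⟨x, hx, rfl⟩
      exact infDist_range_inter_closedBall_le i j _ hε hi hj1 hij hx
    · rintro _ ⟨x, hx, rfl⟩
      exact infDist_range_inter_closedBall_le j i _ hε hj hi1
        (fun f => norm_sub_rev (j f) (i f) ▸ hij f) hx
end
end

section
/- Let 0 ≤ θ₀ < θ₁ < θ₂ < 2π and consider the arcs A₀ = [θ₀, θ₁), A₁ = [θ₁, θ₂), A₂ = [θ₂, θ₀ + 2π). For j = 0, 1, 2 set α_j = (1/2π)·(length of A_j) and β_j = (1/2π)·∫_{A_j} e^{−it} dt ∈ ℂ. Then the three vectors a = (α₀, α₁, α₂), b = (Re β₀, Re β₁, Re β₂) and c = (Im β₀, Im β₁, Im β₂) are linearly independent in ℝ³. Consequently, there exist complex numbers a₀, a₁, a₂ with a₀α₀ + a₁α₁ + a₂α₂ = 0 and a₀β₀ + a₁β₁ + a₂β₂ = −1. -/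
open Real Complex

noncomputable section

theorem integral_exp_neg_mul_I (a b : ℝ) :
    ∫ t in a..b, Complex.exp (-(↑t * Complex.I)) =
      ⟨Real.sin b - Real.sin a, Real.cos b - Real.cos a⟩ := by
  have h : ∀ t : ℝ, Complex.exp (-(↑t * Complex.I)) = Complex.exp (-Complex.I * t) := by
    intro t
    ring_nf
  simp_rw [h]
  rw [integral_exp_mul_complex (neg_ne_zero.mpr Complex.I_ne_zero)]
  have hI : ∀ t : ℝ, Complex.exp (-Complex.I * t) = ⟨Real.cos t, -Real.sin t⟩ := by
    intro t
    rw [show -Complex.I * (t : ℂ) = ((-t : ℝ) : ℂ) * Complex.I by push_cast; ring]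
    apply Complex.ext
    · rw [Complex.exp_ofReal_mul_I_re, Real.cos_neg]
    · rw [Complex.exp_ofReal_mul_I_im, Real.sin_neg]
  rw [hI, hI, div_eq_iff (neg_ne_zero.mpr Complex.I_ne_zero)]
  apply Complex.ext <;> simp
  ring

/-- Twice the signed area of the triangle with vertices on the unit circle. -/
theorem sin_sub_mul_cos_sub_eq_sin_half (x y z : ℝ) :
    (Real.sin y - Real.sin x) * (Real.cos z - Real.cos y) -
      (Real.sin z - Real.sin y) * (Real.cos y - Real.cos x) =
    -4 * Real.sin ((y - x) / 2) * Real.sin ((z - y) / 2) * Real.sin ((z - x) / 2) := by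
  rw [Real.sin_sub_sin, Real.sin_sub_sin, Real.cos_sub_cos, Real.cos_sub_cos,
    show (z - x) / 2 = (z + y) / 2 - (y + x) / 2 by ring, Real.sin_sub ((z + y) / 2)]
  ring

theorem sin_sub_mul_cos_sub_ne_zero {x y z : ℝ} (hxy : x < y) (hyz : y < z)
    (hzx : z < x + 2 * π) :
    (Real.sin y - Real.sin x) * (Real.cos z - Real.cos y) -
      (Real.sin z - Real.sin y) * (Real.cos y - Real.cos x) ≠ 0 := by
  rw [sin_sub_mul_cos_sub_eq_sin_half]
  have h₁ := Real.sin_pos_of_pos_of_lt_pi (x := (y - x) / 2) (by linarith) (by linarith)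
  have h₂ := Real.sin_pos_of_pos_of_lt_pi (x := (z - y) / 2) (by linarith) (by linarith)
  have h₃ := Real.sin_pos_of_pos_of_lt_pi (x := (z - x) / 2) (by linarith) (by linarith)
  simp [h₁.ne', h₂.ne', h₃.ne']

theorem det_eq_of_row_sums (u v w : Fin 3 → ℝ) (hu : ∑ j, u j = 1) (hv : ∑ j, v j = 0)
    (hw : ∑ j, w j = 0) :
    (Matrix.of ![u, v, w]).det = v 0 * w 1 - v 1 * w 0 := by
  simp only [Fin.sum_univ_three] at hu hv hw
  have hu₂ : u 2 = 1 - u 0 - u 1 := by linarith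
  have hv₂ : v 2 = -v 0 - v 1 := by linarith
  have hw₂ : w 2 = -w 0 - w 1 := by linarith
  simp [Matrix.det_fin_three, hu₂, hv₂, hw₂]
  ring

/-- For a partition of the circle into three arcs `A₀ = [θ₀,θ₁)`, `A₁ = [θ₁,θ₂)`,
`A₂ = [θ₂, θ₀+2π)`, with `α_j = (1/2π)·length(A_j)` and `β_j = (1/2π)∫_{A_j} e^{-it} dt`,
the vectors `a = (α₀,α₁,α₂)`, `b = (Re β₀, Re β₁, Re β₂)` and `c = (Im β₀, Im β₁, Im β₂)`
are linearly independent in `ℝ³`; consequently there are complex numbers `a₀,a₁,a₂` with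
`Σ aⱼαⱼ = 0` and `Σ aⱼβⱼ = -1`. -/
theorem statement10 (θ₀ θ₁ θ₂ : ℝ)
    (h0 : 0 ≤ θ₀) (h01 : θ₀ < θ₁) (h12 : θ₁ < θ₂) (h2 : θ₂ < 2 * π)
    (α : Fin 3 → ℝ) (β : Fin 3 → ℂ)
    (hα : α = ![(θ₁ - θ₀) / (2 * π), (θ₂ - θ₁) / (2 * π), (θ₀ + 2 * π - θ₂) / (2 * π)])
    (hβ : β = ![(1 / (2 * π) : ℂ) * ∫ t in θ₀..θ₁, Complex.exp (-(↑t * Complex.I)),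
                (1 / (2 * π) : ℂ) * ∫ t in θ₁..θ₂, Complex.exp (-(↑t * Complex.I)),
                (1 / (2 * π) : ℂ) * ∫ t in θ₂..(θ₀ + 2 * π), Complex.exp (-(↑t * Complex.I))]) :
    LinearIndependent ℝ ![α, fun j => (β j).re, fun j => (β j).im] ∧
    ∃ a : Fin 3 → ℂ, (∑ j, a j * (α j : ℂ)) = 0 ∧ (∑ j, a j * β j) = -1 := by
  have hπ : (2 * π : ℝ) ≠ 0 := by positivity
  have hc : (1 / (2 * π) : ℂ) = ((1 / (2 * π) : ℝ) : ℂ) := by push_cast; rfl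
  simp only [integral_exp_neg_mul_I, hc] at hβ
  have hre : (fun j => (β j).re) = ![1 / (2 * π) * (Real.sin θ₁ - Real.sin θ₀),
      1 / (2 * π) * (Real.sin θ₂ - Real.sin θ₁), 1 / (2 * π) * (Real.sin θ₀ - Real.sin θ₂)] := by
    funext j
    fin_cases j <;> simp only [hβ] <;>
      simp [-Complex.ofReal_mul, -Complex.ofReal_inv]
  have him : (fun j => (β j).im) = ![1 / (2 * π) * (Real.cos θ₁ - Real.cos θ₀),
      1 / (2 * π) * (Real.cos θ₂ - Real.cos θ₁), 1 / (2 * π) * (Real.cos θ₀ - Real.cos θ₂)] := by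
    funext j
    fin_cases j <;> simp only [hβ] <;>
      simp [-Complex.ofReal_mul, -Complex.ofReal_inv]
  set M : Matrix (Fin 3) (Fin 3) ℝ :=
    Matrix.of ![α, fun j => (β j).re, fun j => (β j).im] with hM
  have hdet : M.det ≠ 0 := by
    rw [hM, det_eq_of_row_sums]
    · have h := mul_ne_zero (pow_ne_zero 2 (one_div_ne_zero hπ))
        (sin_sub_mul_cos_sub_ne_zero h01 h12 (by linarith))
      convert h using 1
      simp only [congrFun hre 0, congrFun hre 1, congrFun him 0, congrFun him 1,
        Matrix.cons_val_zero, Matrix.cons_val_one]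
      ring
    · rw [hα, Fin.sum_univ_three]
      simp
      field_simp
      ring
    · rw [hre, Fin.sum_univ_three]
      simp
      ring
    · rw [him, Fin.sum_univ_three]
      simp
      ring
  have hunit : IsUnit M := (Matrix.isUnit_iff_isUnit_det M).mpr hdet.isUnit
  refine ⟨Matrix.linearIndependent_rows_iff_isUnit.mpr hunit, ?_⟩
  obtain ⟨x, hx⟩ := (Matrix.mulVec_surjective_iff_isUnit.mpr hunit) ![0, -1, 0]
  have hx₀ : ∑ j, α j * x j = 0 := congrFun hx 0
  have hx₁ : ∑ j, (β j).re * x j = -1 := congrFun hx 1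
  have hx₂ : ∑ j, (β j).im * x j = 0 := congrFun hx 2
  refine ⟨fun j => (x j : ℂ), ?_, ?_⟩
  · simp_rw [mul_comm (x _ : ℂ)]
    exact_mod_cast hx₀
  · apply Complex.ext
    · simpa [Complex.re_sum, mul_comm] using hx₁
    · simpa [Complex.im_sum, mul_comm] using hx₂
end
end
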